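/- Let k be a perfect field of characteristic p > 0. Then: (a) for X a 3 × 2 matrix of indeterminates, the ring k[[X]]/I_2(X) is strongly F-regular for every p ≥ 2; and (b) for X a 4 × 3 matrix of indeterminates, the ring k[[X]]/I_3(X) is strongly F-regular whenever p ≥ 3. (Here I_t(X) denotes the ideal generated by the t × t minors of X.) -/

import Mathlib

/-- For the generic `3 × 2` matrix `X` over `k[[X]]`, the `2 × 2` minor obtained by deleting
the `i`-th row. -/
noncomputable def Gmin32 (k : Type) [Field k] (i : Fin 3) :
    MvPowerSeries (Fin 3 × Fin 2) k :=
  (Matrix.of fun r c : Fin 2 =>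
    (MvPowerSeries.X (i.succAbove r, c) : MvPowerSeries (Fin 3 × Fin 2) k)).det

/-- `I₂(X)` for the generic `3 × 2` matrix `X`: the ideal of its `2 × 2` minors. -/
noncomputable def I2of32 (k : Type) [Field k] : Ideal (MvPowerSeries (Fin 3 × Fin 2) k) :=
  Ideal.span (Set.range (Gmin32 k))

/-- For the generic `4 × 3` matrix `X` over `k[[X]]`, the `3 × 3` minor obtained by deleting
the `i`-th row. -/
noncomputable def Gmin43 (k : Type) [Field k] (i : Fin 4) :
    MvPowerSeries (Fin 4 × Fin 3) k :=
  (Matrix.of fun r c : Fin 3 =>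
    (MvPowerSeries.X (i.succAbove r, c) : MvPowerSeries (Fin 4 × Fin 3) k)).det

/-- `I₃(X)` for the generic `4 × 3` matrix `X`: the ideal of its `3 × 3` minors. -/
noncomputable def I3of43 (k : Type) [Field k] : Ideal (MvPowerSeries (Fin 4 × Fin 3) k) :=
  Ideal.span (Set.range (Gmin43 k))

/-- `A` is strongly `F`-regular. -/
def StronglyFRegular (p : ℕ) (A : Type) [CommRing A] : Prop :=
  ∀ c : A, (∀ P ∈ minimalPrimes A, c ∉ P) →
    ∃ (e : ℕ) (ψ : A →+ A), 1 ≤ e ∧ (∀ a x : A, ψ (a ^ p ^ e * x) = a * ψ x) ∧ ψ c = 1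


/-- An additive map `ψ : A → A` is `p ^ e`-inverse linear if `ψ (a ^ p ^ e * x) = a * ψ x`. -/
def IsCartier (p e : ℕ) {A : Type*} [CommRing A] (ψ : A →+ A) : Prop :=
  ∀ a x : A, ψ (a ^ p ^ e * x) = a * ψ x

namespace IsCartier

variable {p e e' : ℕ} {A : Type*} [CommRing A] {ψ ψ' : A →+ A}

theorem comp (h : IsCartier p e ψ) (h' : IsCartier p e' ψ') :
    IsCartier p (e + e') (ψ.comp ψ') := fun a x => by
  rw [AddMonoidHom.comp_apply, pow_add, pow_mul, h', h, AddMonoidHom.comp_apply]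

theorem mulLeft (h : IsCartier p e ψ) (r : A) :
    IsCartier p e (ψ.comp (AddMonoidHom.mulLeft r)) := fun a x => by
  simp only [AddMonoidHom.comp_apply, AddMonoidHom.coe_mulLeft]
  rw [← h, mul_left_comm]

/-- If some map of level `e` sends `1` to `1`, then every value at `c` of a map of level `e'` is
also the value at `c` of a map of level `e + e'`. -/
theorem exists_raise (h : IsCartier p e ψ) (h1 : ψ 1 = 1) (hp : p ≠ 0)
    (h' : IsCartier p e' ψ') (c : A) :
    ∃ χ : A →+ A, IsCartier p (e + e') χ ∧ χ c = ψ' c := by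
  refine ⟨_, (h.mulLeft (ψ' c ^ (p ^ e - 1))).comp h', ?_⟩
  simp only [AddMonoidHom.comp_apply, AddMonoidHom.coe_mulLeft]
  rw [← pow_succ, Nat.sub_add_cancel (Nat.pos_of_ne_zero (pow_ne_zero _ hp)), ← mul_one (_ ^ _), h,
    h1, mul_one]

theorem exists_level (h : IsCartier p 1 ψ) (h1 : ψ 1 = 1) (n : ℕ) :
    ∃ χ : A →+ A, IsCartier p n χ ∧ χ 1 = 1 := by
  induction n with
  | zero => exact ⟨AddMonoidHom.id A, fun a x => by simp, rfl⟩
  | succ n ih =>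
    obtain ⟨χ, hχ, hχ1⟩ := ih
    exact ⟨χ.comp ψ, hχ.comp h, by simp [h1, hχ1]⟩

end IsCartier

/-- For an `F`-split ring, the ideal of all values at `c` of Cartier maps. -/
def cartierIdeal {p : ℕ} (hp : p ≠ 0) {A : Type*} [CommRing A] {θ : A →+ A}
    (hθ : IsCartier p 1 θ) (hθ1 : θ 1 = 1) (c : A) : Ideal A where
  carrier := {y | ∃ (e : ℕ) (ψ : A →+ A), IsCartier p e ψ ∧ ψ c = y}
  zero_mem' := ⟨0, 0, fun a x => by simp, rfl⟩
  add_mem' := by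
    rintro _ _ ⟨e, ψ, hψ, rfl⟩ ⟨e', ψ', hψ', rfl⟩
    obtain ⟨θ₁, h₁, h₁'⟩ := hθ.exists_level hθ1 e'
    obtain ⟨θ₂, h₂, h₂'⟩ := hθ.exists_level hθ1 e
    obtain ⟨χ, hχ, hχc⟩ := h₁.exists_raise h₁' hp hψ c
    obtain ⟨χ', hχ', hχc'⟩ := h₂.exists_raise h₂' hp hψ' c
    rw [add_comm] at hχ
    exact ⟨e + e', χ + χ', fun a x => by
      rw [AddMonoidHom.add_apply, hχ, hχ', AddMonoidHom.add_apply, mul_add], by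
      rw [AddMonoidHom.add_apply, hχc, hχc']⟩
  smul_mem' := by
    rintro r _ ⟨e, ψ, hψ, rfl⟩
    exact ⟨e, _, hψ.mulLeft (r ^ p ^ e), by simp [hψ r c]⟩

/-- If `s ^ N * J ≤ J ^ 2` for a finitely generated ideal `J` containing an element outside all
minimal primes, then `J` contains a power of `s`. -/
theorem exists_pow_mem_of_pow_mul_mem_sq {A : Type*} [CommRing A] {J : Ideal A} (hJ : J.FG)
    {s c : A} {N : ℕ} (hs : ∀ f ∈ J, s ^ N * f ∈ J ^ 2) (hcJ : c ∈ J)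
    (hc : ∀ P ∈ minimalPrimes A, c ∉ P) : ∃ M, s ^ M ∈ J := by
  have : Module.Finite A J := Module.Finite.iff_fg.2 hJ
  let f : Module.End A J := algebraMap A _ (s ^ N)
  obtain ⟨P, hP, -, hcoeff, haeval⟩ :=
    LinearMap.exists_monic_and_natDegree_eq_and_coeff_mem_pow_and_aeval_eq_zero A f J (by
      rintro _ ⟨x, rfl⟩
      have h := hs x x.2
      have h2 : ((f x : J) : A) ∈ Submodule.map J.subtype (J • (⊤ : Submodule A J)) := by
        rw [Submodule.map_smul'', Submodule.map_top, Submodule.range_subtype, smul_eq_mul, ← sq]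
        simpa only [f, Submodule.subtype_apply, Module.algebraMap_end_apply, Submodule.coe_smul,
          smul_eq_mul] using h
      obtain ⟨y, hy, hyx⟩ := h2
      have : y = f x := Subtype.ext hyx
      exact this ▸ hy)
  have hr : P.eval (s ^ N) * c = 0 := by
    have h := congrArg (fun g : Module.End A J => ((g ⟨c, hcJ⟩ : J) : A)) haeval
    simp only [f] at h
    rw [Polynomial.aeval_algebraMap_apply] at h
    simpa [Module.algebraMap_end_apply] using h
  have hnil : IsNilpotent (P.eval (s ^ N)) := by
    rw [nilpotent_iff_mem_prime]
    intro Q hQ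
    obtain ⟨q, hq, hqQ⟩ := Ideal.exists_minimalPrimes_le (bot_le : ⊥ ≤ Q)
    have hqp : q.IsPrime := hq.1.1
    refine hqQ ((hqp.mem_or_mem (x := P.eval (s ^ N)) (y := c) ?_).resolve_right (hc q hq))
    rw [hr]; exact q.zero_mem
  have hsub : P.eval (s ^ N) - (s ^ N) ^ P.natDegree ∈ J := by
    rw [Polynomial.eval_eq_sum_range, Finset.sum_range_succ, hP.coeff_natDegree, one_mul,
      add_sub_cancel_right]
    refine J.sum_mem fun i hi => J.mul_mem_right _ ?_
    exact Ideal.pow_le_self (by have := Finset.mem_range.1 hi; omega) (hcoeff i)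
  obtain ⟨L, hL⟩ := hnil
  refine ⟨N * P.natDegree * L, ?_⟩
  rw [← Ideal.Quotient.eq_zero_iff_mem, pow_mul, pow_mul, map_pow,
    ← (Ideal.Quotient.mk_eq_mk_iff_sub_mem _ _).2 hsub, ← map_pow, hL, map_zero]

/-- A criterion for strong `F`-regularity through a test element `s`: some Cartier map sends `s`
to `1`, and up to a power of `s` every `f` lies in the ideal generated by the `p`-th powers of the
values at `f` of the Cartier maps. -/
theorem stronglyFRegular_of_test {p : ℕ} (hp : p.Prime) {A : Type} [CommRing A]
    [IsNoetherianRing A] (s : A) {ϑ : A →+ A} (hϑ : IsCartier p 1 ϑ) (hϑs : ϑ s = 1) (N : ℕ)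
    (hN : ∀ f : A, s ^ N * f ∈
      Ideal.span {y | ∃ ψ : A →+ A, IsCartier p 1 ψ ∧ y = ψ f ^ p}) :
    StronglyFRegular p A := by
  intro c hc
  have hθ := hϑ.mulLeft s
  have hθ1 : (ϑ.comp (AddMonoidHom.mulLeft s)) 1 = 1 := by simp [hϑs]
  set J := cartierIdeal hp.ne_zero hθ hθ1 c with hJ
  have hstable : ∀ ψ : A →+ A, IsCartier p 1 ψ → ∀ f ∈ J, ψ f ∈ J := by
    rintro ψ hψ _ ⟨e, ψ', hψ', rfl⟩
    exact ⟨_, _, hψ.comp hψ', rfl⟩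
  have hcJ : c ∈ J := ⟨0, AddMonoidHom.id A, fun a x => by simp, rfl⟩
  have hsq : ∀ f ∈ J, s ^ N * f ∈ J ^ 2 := by
    intro f hf
    refine Ideal.span_le.2 ?_ (hN f)
    rintro _ ⟨ψ, hψ, rfl⟩
    exact Ideal.pow_le_pow_right hp.two_le (Ideal.pow_mem_pow (hstable ψ hψ f hf) p)
  obtain ⟨M, hM⟩ := exists_pow_mem_of_pow_mul_mem_sq (IsNoetherian.noetherian J) hsq hcJ hc
  have h1 : (1 : A) ∈ J := by
    induction M with
    | zero => simpa using hM
    | succ M ih =>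
      apply ih
      have h : s ^ (p * M + 1) ∈ J := by
        refine J.mem_of_dvd ?_ hM
        refine pow_dvd_pow s ?_
        nlinarith [hp.two_le]
      have h' := hstable ϑ hϑ _ h
      have : ϑ (s ^ (p * M + 1)) = s ^ M := by
        have := hϑ (s ^ M) s
        rwa [pow_one, ← pow_mul, ← pow_succ, hϑs, mul_one, mul_comm M p] at this
      rwa [this] at h'
  obtain ⟨e, ψ, hψ, hψc⟩ := h1
  obtain ⟨χ, hχ, hχc⟩ := hθ.exists_raise hθ1 hp.ne_zero hψ c
  exact ⟨1 + e, χ, by omega, hχ, hχc.trans hψc⟩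

section Trace

open MvPowerSeries

variable {σ : Type} {k : Type} [Field k] {p : ℕ}

/-- The exponent vector all of whose entries are `m`. -/
noncomputable def constExp (σ : Type) [Fintype σ] (m : ℕ) : σ →₀ ℕ :=
  Finsupp.equivFunOnFinite.symm fun _ => m

@[simp]
theorem constExp_apply [Fintype σ] (m : ℕ) (i : σ) : constExp σ m i = m := rfl

/-- The exponent vector of an element of `{0, …, p - 1} ^ σ`. -/
noncomputable def finExp [Fintype σ] (γ : σ → Fin p) : σ →₀ ℕ :=
  Finsupp.equivFunOnFinite.symm fun i => γ i

@[simp]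
theorem finExp_apply [Fintype σ] (γ : σ → Fin p) (i : σ) : finExp γ i = γ i := rfl

theorem exists_smul_eq_of_forall_dvd {n : σ →₀ ℕ} (h : ∀ i, p ∣ n i) : ∃ m : σ →₀ ℕ, n = p • m :=
  ⟨n.mapRange (· / p) (by simp), by ext i; simp [Nat.mul_div_cancel' (h i)]⟩

variable [Fact p.Prime] [CharP k p]

theorem coeff_smul_pow_char (f : MvPowerSeries σ k) (n : σ →₀ ℕ) :
    coeff (p • n) (f ^ p) = coeff n f ^ p := by
  rw [← map_frobenius_expand p (NeZero.ne p), coeff_map, coeff_expand_smul, frobenius_def]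

theorem coeff_pow_char_of_not_dvd (f : MvPowerSeries σ k) {n : σ →₀ ℕ} {i : σ} (h : ¬ p ∣ n i) :
    coeff n (f ^ p) = 0 := by
  rw [← map_frobenius_expand p (NeZero.ne p), coeff_map, coeff_expand_of_not_dvd _ _ _ h, map_zero]

variable [PerfectRing k p] [Fintype σ]

variable (p) in
/-- The trace map of `k[[σ]]`: the coefficient of `x ^ n` in the trace of `f` is the `p`-th root of
the coefficient of `x ^ (p n + p - 1)` in `f`. -/
noncomputable def psTrace : MvPowerSeries σ k →+ MvPowerSeries σ k where
  toFun f := fun n => (frobeniusEquiv k p).symm (coeff (p • n + constExp σ (p - 1)) f)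
  map_zero' := by
    ext n
    exact map_zero (frobeniusEquiv k p).symm
  map_add' f g := by
    ext n
    change (frobeniusEquiv k p).symm _ = (frobeniusEquiv k p).symm _ + (frobeniusEquiv k p).symm _
    rw [← map_add, ← map_add]

theorem coeff_psTrace_pow (f : MvPowerSeries σ k) (n : σ →₀ ℕ) :
    coeff n (psTrace p f) ^ p = coeff (p • n + constExp σ (p - 1)) f := by
  change ((frobeniusEquiv k p).symm _) ^ p = _
  rw [frobeniusEquiv_symm_pow_p]

theorem isCartier_psTrace : IsCartier p 1 (psTrace p : MvPowerSeries σ k →+ _) := by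
  classical
  intro r f
  have hp : p.Prime := Fact.out
  ext n
  apply frobenius_inj k p
  rw [frobenius_def, frobenius_def, pow_one, coeff_psTrace_pow, coeff_mul, coeff_mul, sum_pow_char]
  symm
  refine Finset.sum_of_injOn (fun x => (p • x.1, p • x.2 + constExp σ (p - 1))) ?_ ?_ ?_ ?_
  · rintro ⟨a, b⟩ - ⟨c, d⟩ - h
    simp only [Prod.mk.injEq, add_left_inj, smul_right_inj (NeZero.ne p)] at h
    simp [h]
  · rintro ⟨a, b⟩ h
    have h := Finset.HasAntidiagonal.mem_antidiagonal.1 (Finset.mem_coe.1 h)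
    refine Finset.mem_coe.2 (Finset.HasAntidiagonal.mem_antidiagonal.2 ?_)
    rw [← h, smul_add, add_assoc]
  · rintro ⟨a, b⟩ h h'
    have h := Finset.HasAntidiagonal.mem_antidiagonal.1 h
    by_cases hd : ∀ i, p ∣ a i
    · exfalso
      apply h'
      obtain ⟨a, rfl⟩ := exists_smul_eq_of_forall_dvd hd
      have han : a ≤ n := by
        intro i
        have := DFunLike.congr_fun h i
        simp only [Finsupp.add_apply, Finsupp.smul_apply, smul_eq_mul, constExp_apply] at this
        have h1 : p * a i < p * (n i + 1) := by
          rw [mul_add]; have := hp.pos; omega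
        exact Nat.lt_succ_iff.1 (Nat.lt_of_mul_lt_mul_left h1)
      refine ⟨(a, n - a), by simp [han], ?_⟩
      simp only [Prod.mk.injEq, true_and]
      apply add_left_cancel (a := p • a)
      rw [h, ← add_assoc, ← smul_add, add_tsub_cancel_of_le han]
    · push Not at hd
      obtain ⟨i, hi⟩ := hd
      rw [coeff_pow_char_of_not_dvd r hi, zero_mul]
  · rintro ⟨a, b⟩ -
    rw [mul_pow, coeff_psTrace_pow, coeff_smul_pow_char]

theorem psTrace_pow_mul (r f : MvPowerSeries σ k) : psTrace p (r ^ p * f) = r * psTrace p f := by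
  simpa using isCartier_psTrace (p := p) r f

theorem eq_sum_psTrace_pow [DecidableEq σ] (f : MvPowerSeries σ k) :
    f = ∑ γ : σ → Fin p, psTrace p (monomial (finExp γ) 1 * f) ^ p *
      monomial (constExp σ (p - 1) - finExp γ) 1 := by
  classical
  have hp : p.Prime := Fact.out
  ext m
  rw [map_sum]
  let γ₀ : σ → Fin p := fun i => Fin.rev ⟨m i % p, Nat.mod_lt _ hp.pos⟩
  have hγ₀ : ∀ i, ((γ₀ i : Fin p) : ℕ) = p - 1 - m i % p := fun i => by
    simp only [γ₀, Fin.val_rev]; omega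
  rw [Finset.sum_eq_single γ₀]
  · have hd : ∀ i, (constExp σ (p - 1) - finExp γ₀) i = m i % p := fun i => by
      have := Nat.mod_lt (m i) hp.pos
      rw [Finsupp.tsub_apply, constExp_apply, finExp_apply, hγ₀]; omega
    have hle : constExp σ (p - 1) - finExp γ₀ ≤ m := fun i => by
      rw [hd]; exact Nat.mod_le _ _
    rw [coeff_mul_monomial, if_pos hle, mul_one]
    obtain ⟨n, hn⟩ := exists_smul_eq_of_forall_dvd (p := p)
      (n := m - (constExp σ (p - 1) - finExp γ₀)) (fun i => by
        rw [Finsupp.tsub_apply, hd]; exact Nat.dvd_sub_mod _)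
    rw [hn, coeff_smul_pow_char, coeff_psTrace_pow]
    have : p • n + constExp σ (p - 1) = finExp γ₀ + m := by
      ext i
      have h1 := DFunLike.congr_fun hn i
      have h2 := Nat.mod_lt (m i) hp.pos
      have h3 := Nat.mod_le (m i) p
      rw [Finsupp.tsub_apply, hd] at h1
      rw [Finsupp.add_apply, Finsupp.add_apply, ← h1, constExp_apply, finExp_apply, hγ₀]
      omega
    rw [this, coeff_add_monomial_mul, one_mul]
  · rintro γ - hγ
    rw [coeff_mul_monomial]
    split_ifs with hle
    · rw [mul_one]
      obtain ⟨i, hi⟩ := Function.ne_iff.1 hγ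
      refine coeff_pow_char_of_not_dvd _ (i := i) fun hdvd => hi ?_
      have h1 := hle i
      rw [Finsupp.tsub_apply, Finsupp.tsub_apply, constExp_apply, finExp_apply] at hdvd
      rw [Finsupp.tsub_apply, constExp_apply, finExp_apply] at h1
      have h2 := (γ i).2
      have h3 : m i % p = p - 1 - γ i := by
        have := (Nat.modEq_iff_dvd' h1).2 hdvd
        rw [← this, Nat.mod_eq_of_lt]
        omega
      apply Fin.ext
      rw [hγ₀, h3]
      omega
    · rfl
  · simp

end Trace

section DvdSubring

open MvPowerSeries

variable {σ k : Type} [Field k] {p : ℕ}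

/-- The power series all of whose exponents have entries divisible by `p` at the indices in `T`. -/
def dvdSubring (p : ℕ) (k : Type) [Field k] (T : Set σ) : Subring (MvPowerSeries σ k) where
  carrier := {f | ∀ n, coeff n f ≠ 0 → ∀ i ∈ T, p ∣ n i}
  zero_mem' n h := by simp at h
  one_mem' n h i _ := by
    classical
    rw [coeff_one] at h
    simp [show n = 0 by by_contra h'; simp [h'] at h]
  add_mem' {f g} hf hg n h i hi := by
    by_cases hfn : coeff n f = 0
    · exact hg n (by simpa [hfn] using h) i hi
    · exact hf n hfn i hi
  neg_mem' {f} hf n h i hi := hf n (by simpa using h) i hi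
  mul_mem' {f g} hf hg n h i hi := by
    classical
    rw [coeff_mul] at h
    obtain ⟨x, hx, hx'⟩ := Finset.exists_ne_zero_of_sum_ne_zero h
    rw [← Finset.HasAntidiagonal.mem_antidiagonal.1 hx, Finsupp.add_apply]
    exact dvd_add (hf _ (left_ne_zero_of_mul hx') i hi) (hg _ (right_ne_zero_of_mul hx') i hi)

variable {T : Set σ}

theorem monomial_mem_dvdSubring {n : σ →₀ ℕ} (hn : ∀ i ∈ T, p ∣ n i) (c : k) :
    monomial n c ∈ dvdSubring p k T := fun m h i hi => by
  classical
  rw [coeff_monomial] at h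
  have : m = n := by by_contra h'; simp [h'] at h
  exact this ▸ hn i hi

theorem X_mem_dvdSubring {i : σ} (hi : i ∉ T) : (X i : MvPowerSeries σ k) ∈ dvdSubring p k T :=
  monomial_mem_dvdSubring (fun j hj => by
    rw [Finsupp.single_eq_of_ne (by rintro rfl; exact hi hj)]; exact dvd_zero p) 1

variable [Fact p.Prime] [CharP k p]

theorem pow_char_mem_dvdSubring (f : MvPowerSeries σ k) : f ^ p ∈ dvdSubring p k T :=
  fun _ h i _ => by
    by_contra hd
    exact h (coeff_pow_char_of_not_dvd f hd)

variable [PerfectRing k p] [Fintype σ]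

theorem psTrace_monomial_mul_eq_zero {H : MvPowerSeries σ k} (hH : H ∈ dvdSubring p k T)
    {e : σ →₀ ℕ} {i : σ} (hi : i ∈ T) (he : ¬ p ∣ e i + 1) :
    psTrace p (monomial e 1 * H) = 0 := by
  classical
  have hp : p.Prime := Fact.out
  ext n
  rw [map_zero, ← pow_eq_zero_iff hp.ne_zero, coeff_psTrace_pow, coeff_monomial_mul]
  split_ifs with hle
  · rw [one_mul]
    by_contra h
    have h1 := hH _ h i hi
    have h2 := hle i
    simp only [Finsupp.tsub_apply, Finsupp.add_apply, Finsupp.smul_apply, smul_eq_mul,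
      constExp_apply] at h1 h2
    apply he
    have h3 : p * n i + (p - 1) - e i + (e i + 1) = p * (n i + 1) := by
      rw [mul_add]; have := hp.pos; omega
    exact (Nat.dvd_add_right h1).1 (h3 ▸ dvd_mul_right _ _)
  · rfl

end DvdSubring

section Descent

open MvPowerSeries

theorem Ideal.sup_pow_add_add_one_le {R : Type*} [CommRing R] (I J : Ideal R) (m n : ℕ) :
    (I ⊔ J) ^ (m + n + 1) ≤ I ^ (m + 1) ⊔ J ^ (n + 1) := by
  rw [← Ideal.add_eq_sup, ← Ideal.add_eq_sup, add_pow, Ideal.sum_eq_sup]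
  refine Finset.sup_le fun i hi => ?_
  by_cases hi' : m + 1 ≤ i
  · exact Ideal.mul_le_left.trans (Ideal.mul_le_left.trans
      ((Ideal.pow_le_pow_right hi').trans le_sup_left))
  · exact Ideal.mul_le_left.trans (Ideal.mul_le_right.trans
      ((Ideal.pow_le_pow_right (by omega)).trans le_sup_right))

variable {σ k : Type} [Field k] {p : ℕ} [Fact p.Prime] [CharP k p] [PerfectRing k p] [Fintype σ]
  {I : Ideal (MvPowerSeries σ k)} {s a b : MvPowerSeries σ k}

theorem psTrace_mem_of_mem_sq (ha : a ∈ I) (hb : b ∈ I)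
    (hs : ∀ f ∈ I, s * f ∈ Ideal.span {a, b}) (hnzd : ∀ f, s * f ∈ I → f ∈ I)
    {g : MvPowerSeries σ k} (hg : g ∈ I ^ 2) (h : MvPowerSeries σ k) {f : MvPowerSeries σ k}
    (hf : f ∈ I) : psTrace p (g ^ (p - 1) * h * f) ∈ I := by
  have hp : p.Prime := Fact.out
  have hnzd' : ∀ (n : ℕ) f, s ^ n * f ∈ I → f ∈ I := fun n => by
    induction n with
    | zero => intro f hf; simpa using hf
    | succ n ih => exact fun f hf => ih f (hnzd _ (by rwa [pow_succ', mul_assoc] at hf))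
  have hpow : ∀ n, ∀ x ∈ I ^ n, s ^ n * x ∈ Ideal.span {a, b} ^ n := fun n x hx => by
    have : Ideal.span {s} * I ≤ Ideal.span {a, b} := by
      rw [Ideal.span_singleton_mul_le_iff]; exact hs
    have h2 := Ideal.pow_right_mono this n
    rw [mul_pow, Ideal.span_singleton_pow] at h2
    exact h2 (Ideal.mul_mem_mul (Ideal.mem_span_singleton_self _) hx)
  have h1 : g ^ (p - 1) * f ∈ I ^ (2 * (p - 1) + 1) := by
    rw [pow_succ, pow_mul]
    exact Ideal.mul_mem_mul (Ideal.pow_mem_pow hg _) hf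
  have h2 := hpow _ _ h1
  rw [Ideal.span_insert, two_mul] at h2
  have h3 := Ideal.sup_pow_add_add_one_le _ _ _ _ h2
  rw [Nat.sub_add_cancel hp.one_le, Ideal.span_singleton_pow, Ideal.span_singleton_pow,
    ← Ideal.span_insert, Ideal.mem_span_pair] at h3
  obtain ⟨c, d, hcd⟩ := h3
  apply hnzd' 2
  rw [← psTrace_pow_mul]
  have h4 : (s ^ 2) ^ p * (g ^ (p - 1) * h * f) = a ^ p * (c * s * h) + b ^ p * (d * s * h) := by
    have : (s ^ 2) ^ p = s ^ (p - 1 + (p - 1) + 1) * s := by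
      rw [← pow_mul, ← pow_succ]; congr 1; have := hp.one_le; omega
    rw [this]
    linear_combination (-s * h) * hcd
  rw [h4, map_add, psTrace_pow_mul, psTrace_pow_mul]
  exact I.add_mem (I.mul_mem_right _ ha) (I.mul_mem_right _ hb)

theorem exists_descent {c : MvPowerSeries σ k} (hc : ∀ f ∈ I, psTrace p (c * f) ∈ I) :
    ∃ ψ : (MvPowerSeries σ k ⧸ I) →+ (MvPowerSeries σ k ⧸ I), IsCartier p 1 ψ ∧
      ∀ f, ψ (Ideal.Quotient.mk I f) = Ideal.Quotient.mk I (psTrace p (c * f)) := by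
  let π := (Ideal.Quotient.mk I).toAddMonoidHom
  let ψ := π.liftOfSurjective Ideal.Quotient.mk_surjective
    ⟨π.comp ((psTrace p).comp (AddMonoidHom.mulLeft c)), fun f hf => by
      have hf : f ∈ I := Ideal.Quotient.eq_zero_iff_mem.1 hf
      exact Ideal.Quotient.eq_zero_iff_mem.2 (hc f hf)⟩
  have hψ : ∀ f, ψ (Ideal.Quotient.mk I f) = Ideal.Quotient.mk I (psTrace p (c * f)) := fun f =>
    π.liftOfRightInverse_comp_apply _ _ _ f
  refine ⟨ψ, fun x y => ?_, hψ⟩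
  obtain ⟨x, rfl⟩ := Ideal.Quotient.mk_surjective x
  obtain ⟨y, rfl⟩ := Ideal.Quotient.mk_surjective y
  rw [pow_one, ← map_pow, ← map_mul, hψ, hψ, ← map_mul, mul_left_comm, psTrace_pow_mul]

end Descent

section Criterion

open MvPowerSeries

variable {σ k : Type} [Field k] {p : ℕ}

theorem dvdSubring_anti {T T' : Set σ} (h : T ⊆ T') : dvdSubring p k T' ≤ dvdSubring p k T :=
  fun _ hf n hn i hi => hf n hn i (h hi)

theorem monomial_eq_X_pow_mul_X_pow_mul {u v : σ} (huv : u ≠ v) (e : σ →₀ ℕ) :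
    (monomial e 1 : MvPowerSeries σ k) =
      X u ^ e u * (X v ^ e v * monomial ((e.erase u).erase v) 1) := by
  have : e = Finsupp.single u (e u) + (Finsupp.single v (e v) + (e.erase u).erase v) := by
    conv_lhs => rw [← Finsupp.single_add_erase u e, ← Finsupp.single_add_erase v (e.erase u),
      Finsupp.erase_ne huv.symm]
  conv_lhs => rw [this]
  rw [X_pow_eq, X_pow_eq, monomial_mul_monomial, monomial_mul_monomial, one_mul, one_mul]

theorem monomial_erase_erase_mem_dvdSubring (u v : σ) (e : σ →₀ ℕ) :
    (monomial ((e.erase u).erase v) 1 : MvPowerSeries σ k) ∈ dvdSubring p k {u, v} := by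
  refine monomial_mem_dvdSubring (fun i hi => ?_) 1
  rcases hi with rfl | rfl
  · by_cases h : i = v <;> simp [h, Finsupp.erase_ne]
  · simp

variable [Fact p.Prime] [CharP k p] [PerfectRing k p] [Fintype σ]

theorem psTrace_pow_pred_mul {u : σ} {s a₀ H : MvPowerSeries σ k} (hs : s ∈ dvdSubring p k {u})
    (ha₀ : a₀ ∈ dvdSubring p k {u}) (hH : H ∈ dvdSubring p k {u}) :
    psTrace p ((X u * s + a₀) ^ (p - 1) * H) = psTrace p (X u ^ (p - 1) * (s ^ (p - 1) * H)) := by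
  have hp : p.Prime := Fact.out
  rw [add_pow, Finset.sum_mul, map_sum, Finset.sum_eq_single (p - 1)]
  · congr 1
    simp only [tsub_self, pow_zero, Nat.choose_self, Nat.cast_one]
    ring
  · intro m hm hm'
    have hm1 : m + 1 < p := by
      have := Finset.mem_range.1 hm; have := hp.one_le; omega
    have : (X u * s) ^ m * a₀ ^ (p - 1 - m) * ((p - 1).choose m : MvPowerSeries σ k) * H =
        monomial (Finsupp.single u m) 1 * (s ^ m * a₀ ^ (p - 1 - m) *
          ((p - 1).choose m : MvPowerSeries σ k) * H) := by
      rw [← X_pow_eq]; ring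
    rw [this]
    refine psTrace_monomial_mul_eq_zero (T := {u}) (mul_mem (mul_mem (mul_mem (pow_mem hs _)
      (pow_mem ha₀ _)) (natCast_mem _ _)) hH) rfl ?_
    rw [Finsupp.single_eq_same]
    exact Nat.not_dvd_of_pos_of_lt (Nat.succ_pos m) hm1
  · intro h
    exact absurd (Finset.mem_range.2 (Nat.lt_succ_self _)) h

variable {u v : σ} {s a₀ b₀ : MvPowerSeries σ k}

theorem psTrace_pow_pred_mul_pow_pred_mul (huv : u ≠ v) (hs : s ∈ dvdSubring p k {u, v})
    (ha₀ : a₀ ∈ dvdSubring p k {u, v}) (hb₀ : b₀ ∈ dvdSubring p k {u, v})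
    {H : MvPowerSeries σ k} (hH : H ∈ dvdSubring p k {u, v}) :
    psTrace p (((X u * s + a₀) * (X v * s + b₀)) ^ (p - 1) * H) =
      psTrace p (s ^ (2 * (p - 1)) * (X u ^ (p - 1) * (X v ^ (p - 1) * H))) := by
  have hu : dvdSubring p k {u, v} ≤ dvdSubring p k {u} := dvdSubring_anti (by simp)
  have hv : dvdSubring p k {u, v} ≤ dvdSubring p k {v} := dvdSubring_anti (by simp)
  have hXu : (X u : MvPowerSeries σ k) ∈ dvdSubring p k {v} := X_mem_dvdSubring (by simpa using huv)
  have hXv : (X v : MvPowerSeries σ k) ∈ dvdSubring p k {u} :=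
    X_mem_dvdSubring (by simpa using huv.symm)
  have h1 : (X v * s + b₀) ^ (p - 1) * H ∈ dvdSubring p k {u} := mul_mem (pow_mem (add_mem
    (mul_mem hXv (hu hs)) (hu hb₀)) _) (hu hH)
  have h2 : X u ^ (p - 1) * (s ^ (p - 1) * H) ∈ dvdSubring p k {v} :=
    mul_mem (pow_mem hXu _) (mul_mem (pow_mem (hv hs) _) (hv hH))
  rw [mul_pow, mul_assoc, psTrace_pow_pred_mul (hu hs) (hu ha₀) h1]
  have : X u ^ (p - 1) * (s ^ (p - 1) * ((X v * s + b₀) ^ (p - 1) * H)) =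
      (X v * s + b₀) ^ (p - 1) * (X u ^ (p - 1) * (s ^ (p - 1) * H)) := by ring
  rw [this, psTrace_pow_pred_mul (hv hs) (hv hb₀) h2]
  congr 1
  ring

theorem exists_mem_dvdSubring_sub_mem {I : Ideal (MvPowerSeries σ k)} (huv : u ≠ v)
    (ha : X u * s + a₀ ∈ I) (hb : X v * s + b₀ ∈ I) (hs : s ∈ dvdSubring p k {u, v})
    (ha₀ : a₀ ∈ dvdSubring p k {u, v}) (hb₀ : b₀ ∈ dvdSubring p k {u, v})
    (f : MvPowerSeries σ k) :
    ∃ F ∈ dvdSubring p k {u, v}, s ^ (2 * (p - 1)) * f - F ∈ I := by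
  classical
  let β : (σ → Fin p) → σ →₀ ℕ := fun γ => constExp σ (p - 1) - finExp γ
  have hβ : ∀ γ i, β γ i ≤ p - 1 := fun γ i => by simp [β]
  refine ⟨∑ γ : σ → Fin p, psTrace p (monomial (finExp γ) 1 * f) ^ p *
    ((s ^ (p - 1 - β γ u) * (-a₀) ^ β γ u) * ((s ^ (p - 1 - β γ v) * (-b₀) ^ β γ v) *
      monomial (((β γ).erase u).erase v) 1)), ?_, ?_⟩
  · exact sum_mem fun γ _ => mul_mem (pow_char_mem_dvdSubring _) (mul_mem (mul_mem (pow_mem hs _)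
      (pow_mem (neg_mem ha₀) _)) (mul_mem (mul_mem (pow_mem hs _) (pow_mem (neg_mem hb₀) _))
        (monomial_erase_erase_mem_dvdSubring u v _)))
  · have key : ∀ {x c : MvPowerSeries σ k} {i : ℕ}, i ≤ p - 1 → x * s + c ∈ I →
        Ideal.Quotient.mk I s ^ (p - 1) * Ideal.Quotient.mk I x ^ i =
          Ideal.Quotient.mk I s ^ (p - 1 - i) * (-Ideal.Quotient.mk I c) ^ i := by
      intro x c i hi h
      have : -Ideal.Quotient.mk I c = Ideal.Quotient.mk I x * Ideal.Quotient.mk I s := by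
        have := Ideal.Quotient.eq_zero_iff_mem.2 h
        rw [map_add, map_mul] at this
        linear_combination -this
      rw [this, ← Nat.sub_add_cancel hi, pow_add, Nat.add_sub_cancel]
      ring
    rw [← Ideal.Quotient.eq]
    conv_lhs => rw [eq_sum_psTrace_pow (p := p) f]
    rw [Finset.mul_sum, map_sum, map_sum]
    refine Finset.sum_congr rfl fun γ _ => ?_
    rw [show constExp σ (p - 1) - finExp γ = β γ from rfl,
      monomial_eq_X_pow_mul_X_pow_mul huv (β γ)]
    simp only [map_mul, map_pow, map_neg]
    rw [← key (hβ γ u) ha, ← key (hβ γ v) hb]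
    ring

/-- A criterion for strong `F`-regularity of a quotient of `k[[σ]]` in which an element `s` can be
inverted so as to obtain a regular ring. -/
theorem stronglyFRegular_quotient {I : Ideal (MvPowerSeries σ k)} (huv : u ≠ v)
    (ha : X u * s + a₀ ∈ I) (hb : X v * s + b₀ ∈ I) (hs₀ : s ∈ dvdSubring p k {u, v})
    (ha₀ : a₀ ∈ dvdSubring p k {u, v}) (hb₀ : b₀ ∈ dvdSubring p k {u, v})
    (hs : ∀ f ∈ I, s * f ∈ Ideal.span {X u * s + a₀, X v * s + b₀})
    (hnzd : ∀ f, s * f ∈ I → f ∈ I) {g h : MvPowerSeries σ k} (hg : g ∈ I ^ 2)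
    (hcoeff : coeff (constExp σ (p - 1)) (g ^ (p - 1) * h * s) ≠ 0) :
    StronglyFRegular p (MvPowerSeries σ k ⧸ I) := by
  classical
  have hp : p.Prime := Fact.out
  obtain ⟨w, hw⟩ : IsUnit (psTrace p (g ^ (p - 1) * h * s)) := by
    rw [MvPowerSeries.isUnit_iff_constantCoeff, isUnit_iff_ne_zero, ← pow_ne_zero_iff hp.ne_zero,
      ← coeff_zero_eq_constantCoeff_apply, coeff_psTrace_pow, smul_zero, zero_add]
    exact hcoeff
  obtain ⟨ϑ, hϑ, hϑ'⟩ := exists_descent (I := I) (c := (↑w⁻¹ : MvPowerSeries σ k) ^ p *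
      (g ^ (p - 1) * h)) fun f hf => by
    rw [mul_assoc, psTrace_pow_mul]
    exact I.mul_mem_left _ (psTrace_mem_of_mem_sq ha hb hs hnzd hg h hf)
  have hϑs : ϑ (Ideal.Quotient.mk I s) = 1 := by
    rw [hϑ', mul_assoc, psTrace_pow_mul, ← hw, Units.inv_mul, map_one]
  refine stronglyFRegular_of_test hp _ hϑ hϑs (2 * p + 2 * (p - 1)) fun f => ?_
  obtain ⟨f, rfl⟩ := Ideal.Quotient.mk_surjective f
  obtain ⟨F, hF, hFf⟩ := exists_mem_dvdSubring_sub_mem huv ha hb hs₀ ha₀ hb₀ f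
  have hFf' : Ideal.Quotient.mk I (s ^ (2 * p) * F) =
      Ideal.Quotient.mk I s ^ (2 * p + 2 * (p - 1)) * Ideal.Quotient.mk I f := by
    have := Ideal.Quotient.eq_zero_iff_mem.2 hFf
    simp only [map_sub, map_mul, map_pow] at this ⊢
    linear_combination (-Ideal.Quotient.mk I s ^ (2 * p)) * this
  rw [← hFf', eq_sum_psTrace_pow (p := p) F, Finset.mul_sum, map_sum]
  refine sum_mem fun γ _ => ?_
  rw [← mul_assoc, map_mul]
  refine Ideal.mul_mem_right _ _ ?_
  by_cases hγ : finExp γ u = p - 1 ∧ finExp γ v = p - 1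
  · let e := ((finExp γ).erase u).erase v
    have hab : (X u * s + a₀) * (X v * s + b₀) ∈ I ^ 2 := by
      rw [sq]; exact Ideal.mul_mem_mul ha hb
    let h' : MvPowerSeries σ k := s ^ 2 * monomial e 1
    have hmem := fun f hf => psTrace_mem_of_mem_sq (p := p) (f := f) ha hb hs hnzd hab
      (h' * s ^ (2 * (p - 1))) hf
    obtain ⟨ψ, hψ, hψ'⟩ := exists_descent (p := p) hmem
    refine Ideal.subset_span ⟨ψ, hψ, ?_⟩
    rw [hψ', ← map_pow (Ideal.Quotient.mk I)]
    have h1 : Ideal.Quotient.mk I (psTrace p (((X u * s + a₀) * (X v * s + b₀)) ^ (p - 1) *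
        (h' * s ^ (2 * (p - 1))) * f)) = Ideal.Quotient.mk I (psTrace p
          (((X u * s + a₀) * (X v * s + b₀)) ^ (p - 1) * (h' * F))) := by
      rw [Ideal.Quotient.eq, ← map_sub]
      have := psTrace_mem_of_mem_sq (p := p) ha hb hs hnzd hab h' hFf
      convert this using 2
      ring
    rw [map_pow (Ideal.Quotient.mk I), h1, psTrace_pow_pred_mul_pow_pred_mul huv hs₀ ha₀ hb₀
      (mul_mem (mul_mem (pow_mem hs₀ _) (monomial_erase_erase_mem_dvdSubring u v _)) hF),
      ← map_pow (Ideal.Quotient.mk I)]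
    congr 1
    rw [pow_mul, ← mul_pow, ← psTrace_pow_mul]
    congr 2
    rw [monomial_eq_X_pow_mul_X_pow_mul huv (finExp γ), hγ.1, hγ.2, ← pow_mul]
    have : 2 * p = 2 * (p - 1) + 2 := by have := hp.one_le; omega
    rw [this, pow_add]
    ring
  · have : psTrace p (monomial (finExp γ) 1 * F) = 0 := by
      have haux : ∀ i, finExp γ i ≠ p - 1 → ¬ p ∣ finExp γ i + 1 := fun i hi => by
        have := (γ i).2
        rw [finExp_apply] at hi ⊢
        exact Nat.not_dvd_of_pos_of_lt (Nat.succ_pos _) (by omega)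
      rcases not_and_or.1 hγ with hγ | hγ
      · exact psTrace_monomial_mul_eq_zero hF (Set.mem_insert u _) (haux u hγ)
      · exact psTrace_monomial_mul_eq_zero hF (Set.mem_insert_of_mem u rfl) (haux v hγ)
    rw [this, zero_pow hp.ne_zero, mul_zero, map_zero]
    exact zero_mem _

end Criterion

/-- The element `r` is a nonzerodivisor modulo the ideal `J`. -/
def RegularMod {R : Type*} [CommRing R] (J : Ideal R) (r : R) : Prop := ∀ x, r * x ∈ J → x ∈ J

namespace RegularMod

variable {R : Type*} [CommRing R] {J : Ideal R} {r : R}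

theorem sup_mul {x z : R} (hx : RegularMod J x) (hrx : RegularMod (J ⊔ Ideal.span {x}) r)
    (hrz : RegularMod (J ⊔ Ideal.span {z}) r) : RegularMod (J ⊔ Ideal.span {x * z}) r := by
  intro f hf
  obtain ⟨j, hj, t, ht, hjt⟩ := Submodule.mem_sup.1 hf
  obtain ⟨t, rfl⟩ := Ideal.mem_span_singleton'.1 ht
  have hmem : ∀ {y : R}, y ∈ Ideal.span {x * z} → y ∈ J ⊔ Ideal.span {x} := fun hy =>
    (Ideal.span_singleton_le_span_singleton.2 (dvd_mul_right x z)).trans le_sup_right hy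
  obtain ⟨j', hj', y, hy, rfl⟩ := Submodule.mem_sup.1 (hrx f (hjt ▸ Ideal.add_mem _
    (Ideal.mem_sup_left hj) (hmem ht)))
  obtain ⟨y, rfl⟩ := Ideal.mem_span_singleton'.1 hy
  have h1 : r * y - z * t ∈ J := hx _ (by
    rw [show x * (r * y - z * t) = j - r * j' by linear_combination -hjt]
    exact J.sub_mem hj (J.mul_mem_left r hj'))
  have h2 : y ∈ J ⊔ Ideal.span {z} := hrz y (by
    rw [show r * y = r * y - z * t + t * z by ring]
    exact Ideal.add_mem _ (Ideal.mem_sup_left h1)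
      (Ideal.mem_sup_right (Ideal.mem_span_singleton'.2 ⟨t, rfl⟩)))
  obtain ⟨j'', hj'', w, hw, rfl⟩ := Submodule.mem_sup.1 h2
  obtain ⟨w, rfl⟩ := Ideal.mem_span_singleton'.1 hw
  rw [show j' + (j'' + w * z) * x = j' + j'' * x + w * (x * z) by ring]
  exact Ideal.add_mem _ (Ideal.mem_sup_left (J.add_mem hj' (J.mul_mem_right _ hj'')))
    (Ideal.mem_sup_right (Ideal.mem_span_singleton'.2 ⟨w, rfl⟩))

theorem sup_prod {ι : Type*} {B : Finset ι} {x : ι → R} (hx : ∀ i ∈ B, RegularMod J (x i))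
    (hr : ∀ i ∈ B, RegularMod (J ⊔ Ideal.span {x i}) r) :
    RegularMod (J ⊔ Ideal.span {∏ i ∈ B, x i}) r := by
  classical
  induction B using Finset.induction_on with
  | empty => intro f _; simp
  | insert i B hi ih =>
    rw [Finset.prod_insert hi]
    exact sup_mul (hx i (B.mem_insert_self i)) (hr i (B.mem_insert_self i))
      (ih (fun j hj => hx j (Finset.mem_insert_of_mem hj))
        (fun j hj => hr j (Finset.mem_insert_of_mem hj)))

end RegularMod

section Kill

open MvPowerSeries

variable {σ k : Type} [Field k]

theorem mem_span_X_image_of_coeff_eq_zero [DecidableEq σ] (A : Finset σ) {f : MvPowerSeries σ k}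
    (hf : ∀ n : σ →₀ ℕ, (∀ i ∈ A, n i = 0) → coeff n f = 0) :
    f ∈ Ideal.span ((X : σ → MvPowerSeries σ k) '' A) := by
  induction A using Finset.induction_on generalizing f with
  | empty => rw [show f = 0 from MvPowerSeries.ext fun n => hf n (by simp)]; exact zero_mem _
  | insert i A hi ih =>
    let f₀ : MvPowerSeries σ k := fun n => if n i = 0 then coeff n f else 0
    have hf₀ : ∀ n, coeff n f₀ = if n i = 0 then coeff n f else 0 := fun n => rfl
    rw [Finset.coe_insert, Set.image_insert_eq, Ideal.span_insert, ← sub_add_cancel f f₀]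
    refine Ideal.add_mem _ (Ideal.mem_sup_left ?_) (Ideal.mem_sup_right (ih fun n hn => ?_))
    · rw [Ideal.mem_span_singleton, X_dvd_iff]
      intro n hn
      rw [map_sub, hf₀, if_pos hn, sub_self]
    · rw [hf₀]
      split_ifs with h
      · exact hf n (by simp [h]; exact hn)
      · rfl

theorem regularMod_span_X_image [DecidableEq σ] (A : Finset σ) {r : MvPowerSeries σ k}
    {n : σ →₀ ℕ} (hn : ∀ i ∈ A, n i = 0) (hr : coeff n r ≠ 0) :
    RegularMod (Ideal.span ((X : σ → MvPowerSeries σ k) '' A)) r := by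
  let e : {i // i ∉ A} ↪ σ := Function.Embedding.subtype _
  have he : ∀ n : σ →₀ ℕ, (∀ i ∈ A, n i = 0) → ∃ m, Finsupp.embDomain e m = n := fun n hn => by
    refine (Finsupp.mem_range_embDomain_iff e n).2 fun i hi => ?_
    exact ⟨⟨i, fun hA => Finsupp.mem_support_iff.1 hi (hn i hA)⟩, rfl⟩
  have hK : ∀ f ∈ Ideal.span ((X : σ → MvPowerSeries σ k) '' A), killCompl e f = 0 := by
    intro f hf
    have : Ideal.span ((X : σ → MvPowerSeries σ k) '' A) ≤ RingHom.ker (killCompl (R := k) e) := by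
      rw [Ideal.span_le]
      rintro _ ⟨i, hi, rfl⟩
      exact killCompl_X_eq_zero (by rintro ⟨j, rfl⟩; exact j.2 hi)
    exact this hf
  intro f hf
  have h := hK _ hf
  rw [map_mul, mul_eq_zero] at h
  rcases h with h | h
  · obtain ⟨m, rfl⟩ := he n hn
    exact absurd (by rw [← coeff_killCompl, h, map_zero]) hr
  · refine mem_span_X_image_of_coeff_eq_zero A fun n hn => ?_
    obtain ⟨m, rfl⟩ := he n hn
    rw [← coeff_killCompl, h, map_zero]

theorem regularMod_span_X_image_sup [DecidableEq σ] (A : Finset σ) {B : Finset σ}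
    (hAB : Disjoint A B) {r : MvPowerSeries σ k} {n : σ →₀ ℕ} (hA : ∀ i ∈ A, n i = 0)
    (hB : ∀ i ∈ B, n i = 0) (hr : coeff n r ≠ 0) :
    RegularMod (Ideal.span ((X : σ → MvPowerSeries σ k) '' A) ⊔ Ideal.span {∏ i ∈ B, X i}) r := by
  refine RegularMod.sup_prod (fun i hi => ?_) (fun i hi => ?_)
  · refine regularMod_span_X_image A (n := Finsupp.single i 1) (fun j hj => ?_) (by simp)
    exact Finsupp.single_eq_of_ne (by rintro rfl; exact Finset.disjoint_left.1 hAB hj hi)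
  · rw [sup_comm, ← Ideal.span_insert, ← Set.image_insert_eq, ← Finset.coe_insert]
    refine regularMod_span_X_image _ (fun j hj => ?_) hr
    rcases Finset.mem_insert.1 hj with rfl | hj
    exacts [hB _ hi, hA _ hj]

theorem regularMod_span_X_image_sup_sup [DecidableEq σ] (A : Finset σ) {B C : Finset σ}
    (hAB : Disjoint A B) (hAC : Disjoint A C) (hBC : Disjoint B C) {r : MvPowerSeries σ k}
    {n : σ →₀ ℕ} (hA : ∀ i ∈ A, n i = 0) (hB : ∀ i ∈ B, n i = 0) (hC : ∀ i ∈ C, n i = 0)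
    (hr : coeff n r ≠ 0) :
    RegularMod (Ideal.span ((X : σ → MvPowerSeries σ k) '' A) ⊔ Ideal.span {∏ i ∈ B, X i} ⊔
      Ideal.span {∏ i ∈ C, X i}) r := by
  refine RegularMod.sup_prod (fun i hi => ?_) (fun i hi => ?_)
  · refine regularMod_span_X_image_sup A hAB (n := Finsupp.single i 1) (fun j hj => ?_)
      (fun j hj => ?_) (by simp)
    · exact Finsupp.single_eq_of_ne (by rintro rfl; exact Finset.disjoint_left.1 hAC hj hi)
    · exact Finsupp.single_eq_of_ne (by rintro rfl; exact Finset.disjoint_left.1 hBC hj hi)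
  · rw [sup_comm, ← sup_assoc, ← Ideal.span_insert, ← Set.image_insert_eq, ← Finset.coe_insert]
    refine regularMod_span_X_image_sup _ ?_ (fun j hj => ?_) hB hr
    · rw [Finset.disjoint_insert_left]
      exact ⟨fun h => Finset.disjoint_left.1 hBC h hi, hAB⟩
    · rcases Finset.mem_insert.1 hj with rfl | hj
      exacts [hC _ hi, hA _ hj]

end Kill

section MaximalMinors

variable {R : Type*} [CommRing R] {n : ℕ}

/-- The maximal minor of an `(n + 1) × n` matrix obtained by deleting the `i`-th row. -/
def maximalMinor (M : Matrix (Fin (n + 1)) (Fin n) R) (i : Fin (n + 1)) : R :=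
  (M.submatrix i.succAbove id).det

open Matrix

theorem sum_maximalMinor_mul (M : Matrix (Fin (n + 1)) (Fin n) R) (j : Fin n) :
    ∑ i : Fin (n + 1), (-1) ^ (i : ℕ) * M i j * maximalMinor M i = 0 := by
  have h := det_succ_column_zero (of fun i => (Fin.cons (M i j) (M i) : Fin (n + 1) → R))
  rw [det_zero_of_column_eq (Fin.succ_ne_zero j).symm (fun i => by simp)] at h
  rw [h]
  rfl

theorem sum_mulVec_mul_maximalMinor (M : Matrix (Fin (n + 1)) (Fin n) R) (v : Fin n → R) :
    ∑ i : Fin (n + 1), (-1) ^ (i : ℕ) * (M *ᵥ v) i * maximalMinor M i = 0 := by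
  simp only [mulVec, dotProduct, Finset.mul_sum, Finset.sum_mul]
  rw [Finset.sum_comm]
  refine Finset.sum_eq_zero fun j _ => ?_
  rw [← mul_zero (v j), ← sum_maximalMinor_mul M j, Finset.mul_sum]
  exact Finset.sum_congr rfl fun _ _ => by ring

theorem maximalMinor_mul_of_sum_eq_zero (M : Matrix (Fin (n + 1)) (Fin n) R) (i : Fin (n + 1))
    {c : Fin (n + 1) → R} (hD : ∀ x, maximalMinor M i * x = 0 → x = 0)
    (hc : ∑ i : Fin (n + 1), (-1) ^ (i : ℕ) * c i * maximalMinor M i = 0) :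
    maximalMinor M i • c =
      M *ᵥ ((M.submatrix i.succAbove id).adjugate *ᵥ (c ∘ i.succAbove)) := by
  set w := (M.submatrix i.succAbove id).adjugate *ᵥ (c ∘ i.succAbove) with hw
  have hsucc : ∀ t, maximalMinor M i * c (i.succAbove t) = (M *ᵥ w) (i.succAbove t) := fun t => by
    have h : M.submatrix i.succAbove id *ᵥ w = maximalMinor M i • (c ∘ i.succAbove) := by
      rw [hw, mulVec_mulVec, mul_adjugate, smul_mulVec, one_mulVec, maximalMinor]
    exact (congrFun h t).symm
  have hi : maximalMinor M i * c i = (M *ᵥ w) i := by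
    have h : ∑ r : Fin (n + 1),
        (-1) ^ (r : ℕ) * (maximalMinor M i * c r - (M *ᵥ w) r) * maximalMinor M r = 0 := by
      have h1 := congrArg₂ (maximalMinor M i * · - ·) hc (sum_mulVec_mul_maximalMinor M w)
      simp only [mul_zero, sub_zero, Finset.mul_sum, ← Finset.sum_sub_distrib] at h1
      rw [← h1]
      exact Finset.sum_congr rfl fun _ _ => by ring
    rw [Fin.sum_univ_succAbove _ i] at h
    simp only [hsucc, sub_self, mul_zero, zero_mul, Finset.sum_const_zero, add_zero] at h
    have h2 := hD (maximalMinor M i * c i - (M *ᵥ w) i) (by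
      have := congrArg ((-1) ^ (i : ℕ) * ·) h
      simp only [← mul_assoc, ← pow_add, ← two_mul, mul_zero] at this
      rw [pow_mul] at this
      linear_combination (by simpa using this :
        (maximalMinor M i * c i - (M *ᵥ w) i) * maximalMinor M i = 0))
    exact sub_eq_zero.1 h2
  ext r
  rw [Pi.smul_apply, smul_eq_mul]
  rcases Fin.eq_self_or_eq_succAbove i r with rfl | ⟨t, rfl⟩
  exacts [hi, hsucc t]

/-- The exactness in the middle of the Hilbert–Burch complex. -/
theorem exists_eq_mulVec_of_sum_maximalMinor_eq_zero (M : Matrix (Fin (n + 1)) (Fin n) R)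
    (i j : Fin (n + 1)) (hi : ∀ x, maximalMinor M i * x = 0 → x = 0)
    (hj : ∀ x, maximalMinor M i ∣ maximalMinor M j * x → maximalMinor M i ∣ x)
    {c : Fin (n + 1) → R} (hc : ∑ i : Fin (n + 1), (-1) ^ (i : ℕ) * c i * maximalMinor M i = 0) :
    ∃ v, c = M *ᵥ v := by
  have h := maximalMinor_mul_of_sum_eq_zero M i hi hc
  set w := (M.submatrix i.succAbove id).adjugate *ᵥ (c ∘ i.succAbove)
  have hw : maximalMinor M j • w = maximalMinor M i •
      ((M.submatrix j.succAbove id).adjugate *ᵥ (c ∘ j.succAbove)) := by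
    have h1 : M.submatrix j.succAbove id *ᵥ w = maximalMinor M i • (c ∘ j.succAbove) :=
      funext fun t => (congrFun h (j.succAbove t)).symm
    rw [← mulVec_smul (M.submatrix j.succAbove id).adjugate, ← h1, mulVec_mulVec, adjugate_mul,
      smul_mulVec, one_mulVec, maximalMinor]
  have hdvd : ∀ t, maximalMinor M i ∣ w t := fun t => hj _ ⟨_, congrFun hw t⟩
  choose v hv using hdvd
  refine ⟨v, funext fun r => sub_eq_zero.1 (hi _ ?_)⟩
  have hwv : w = maximalMinor M i • v := funext hv
  have := congrFun h r
  rw [hwv, mulVec_smul, Pi.smul_apply, Pi.smul_apply, smul_eq_mul, smul_eq_mul] at this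
  rw [mul_sub, this, sub_self]

theorem map_maximalMinor {S : Type*} [CommRing S] (φ : R →+* S)
    (M : Matrix (Fin (n + 1)) (Fin n) R) (i : Fin (n + 1)) :
    maximalMinor (M.map φ) i = φ (maximalMinor M i) := by
  rw [maximalMinor, maximalMinor, RingHom.map_det]
  rfl

/-- If `s`, `D i`, `D j` is a regular sequence, where the `D i` are the maximal minors of `M`, then
`s` is a nonzerodivisor modulo the ideal of maximal minors. -/
theorem regularMod_span_maximalMinor [NoZeroDivisors R] (M : Matrix (Fin (n + 1)) (Fin n) R) {s : R}
    (hs : s ≠ 0) (i j : Fin (n + 1)) (hi : RegularMod (Ideal.span {s}) (maximalMinor M i))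
    (hj : RegularMod (Ideal.span {s} ⊔ Ideal.span {maximalMinor M i}) (maximalMinor M j)) :
    RegularMod (Ideal.span (Set.range (maximalMinor M))) s := by
  intro f hf
  obtain ⟨c, hc⟩ := Ideal.mem_span_range_iff_exists_fun.1 hf
  let π := Ideal.Quotient.mk (Ideal.span {s})
  have hπ : ∀ x y, π x ∣ π y ↔ y ∈ Ideal.span {s} ⊔ Ideal.span {x} := fun x y => by
    constructor
    · rintro ⟨z, hz⟩
      obtain ⟨z, rfl⟩ := Ideal.Quotient.mk_surjective z
      rw [← map_mul, Ideal.Quotient.eq] at hz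
      rw [← sub_add_cancel y (x * z)]
      exact Ideal.add_mem _ (Ideal.mem_sup_left hz)
        (Ideal.mem_sup_right (Ideal.mem_span_singleton.2 (dvd_mul_right x z)))
    · intro h
      obtain ⟨a, ha, b, hb, rfl⟩ := Submodule.mem_sup.1 h
      rw [map_add, Ideal.Quotient.eq_zero_iff_mem.2 ha, zero_add]
      exact map_dvd π (Ideal.mem_span_singleton.1 hb)
  obtain ⟨v, hv⟩ := exists_eq_mulVec_of_sum_maximalMinor_eq_zero (M.map π) i j
    (c := fun r => π ((-1) ^ (r : ℕ) * c r))
    (fun x hx => by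
      obtain ⟨x, rfl⟩ := Ideal.Quotient.mk_surjective x
      rw [map_maximalMinor, ← map_mul] at hx
      exact Ideal.Quotient.eq_zero_iff_mem.2 (hi x (Ideal.Quotient.eq_zero_iff_mem.1 hx)))
    (fun x hx => by
      obtain ⟨x, rfl⟩ := Ideal.Quotient.mk_surjective x
      rw [map_maximalMinor, map_maximalMinor, ← map_mul] at hx
      rw [map_maximalMinor]
      exact (hπ _ _).2 (hj x ((hπ _ _).1 hx)))
    (by
      have : ∑ r, c r * maximalMinor M r ∈ Ideal.span {s} :=
        hc ▸ Ideal.mem_span_singleton.2 (dvd_mul_right s f)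
      rw [← Ideal.Quotient.eq_zero_iff_mem, map_sum] at this
      rw [← this]
      refine Finset.sum_congr rfl fun r _ => ?_
      rw [map_maximalMinor, map_mul, map_mul, map_pow, map_neg, map_one, ← mul_assoc, ← mul_pow,
        neg_one_mul, neg_neg, one_pow, one_mul])
  choose v' hv' using fun t => Ideal.Quotient.mk_surjective (v t)
  obtain rfl : v = fun t => π (v' t) := funext fun t => (hv' t).symm
  have hdvd : ∀ r : Fin (n + 1), s ∣ (-1) ^ (r : ℕ) * c r - (M *ᵥ v') r := fun r => by
    rw [← Ideal.mem_span_singleton, ← Ideal.Quotient.eq]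
    have := congrFun hv r
    simp only [mulVec, dotProduct, map_sum, map_mul, map_apply] at this ⊢
    exact this
  choose w hw using hdvd
  refine Ideal.mem_span_range_iff_exists_fun.2 ⟨fun r => (-1) ^ (r : ℕ) * w r, ?_⟩
  apply mul_left_cancel₀ hs
  rw [← hc, Finset.mul_sum, ← add_zero (Finset.sum _ _), ← sum_mulVec_mul_maximalMinor M v',
    ← Finset.sum_add_distrib]
  refine Finset.sum_congr rfl fun r _ => ?_
  have hsq : ((-1 : R) ^ (r : ℕ)) * (-1) ^ (r : ℕ) = 1 := by
    rw [← mul_pow, neg_one_mul, neg_neg, one_pow]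
  linear_combination (-(-1) ^ (r : ℕ) * maximalMinor M r) * hw r +
    (c r * maximalMinor M r) * hsq

end MaximalMinors

section Lead

open MvPowerSeries

variable {σ k : Type} [Field k]

/-- With respect to the weights `ω`, the lowest weight part of `f` is `c` times the monomial with
exponent `m`. -/
def HasLead (ω : σ → ℕ) (f : MvPowerSeries σ k) (m : σ →₀ ℕ) (c : k) : Prop :=
  coeff m f = c ∧
    ∀ n, n ≠ m → Finsupp.weight ω n ≤ Finsupp.weight ω m → coeff n f = 0

namespace HasLead

variable {ω : σ → ℕ} {f g : MvPowerSeries σ k} {m m' : σ →₀ ℕ} {c d : k}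

protected theorem monomial (ω : σ → ℕ) (m : σ →₀ ℕ) (c : k) : HasLead ω (monomial m c) m c := by
  classical
  exact ⟨coeff_monomial_same m c, fun n hn _ => coeff_monomial_ne hn c⟩

protected theorem X (ω : σ → ℕ) (i : σ) :
    HasLead ω (X i : MvPowerSeries σ k) (Finsupp.single i 1) 1 :=
  HasLead.monomial ω _ 1

theorem coeff_ne_zero (hf : HasLead ω f m c) (hc : c ≠ 0) : coeff m f ≠ 0 := by
  rwa [hf.1]

theorem ne_zero (hf : HasLead ω f m c) (hc : c ≠ 0) : f ≠ 0 := by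
  rintro rfl
  exact hf.coeff_ne_zero hc (map_zero _)

theorem neg (hf : HasLead ω f m c) : HasLead ω (-f) m (-c) :=
  ⟨by rw [map_neg, hf.1], fun n hn h => by rw [map_neg, hf.2 n hn h, neg_zero]⟩

theorem add (hf : HasLead ω f m c) (hg : HasLead ω g m' d)
    (h : Finsupp.weight ω m < Finsupp.weight ω m') : HasLead ω (f + g) m c := by
  have hg' : ∀ n, Finsupp.weight ω n ≤ Finsupp.weight ω m → coeff n g = 0 := fun n hn =>
    hg.2 n (by rintro rfl; omega) (by omega)
  exact ⟨by rw [map_add, hf.1, hg' m le_rfl, add_zero],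
    fun n hn hw => by rw [map_add, hf.2 n hn hw, hg' n hw, add_zero]⟩

theorem mul (hf : HasLead ω f m c) (hg : HasLead ω g m' d) :
    HasLead ω (f * g) (m + m') (c * d) := by
  classical
  have key : ∀ a b, Finsupp.weight ω (a + b) ≤ Finsupp.weight ω (m + m') → (a, b) ≠ (m, m') →
      coeff a f * coeff b g = 0 := fun a b hw hab => by
    rw [map_add, map_add] at hw
    rcases lt_or_ge (Finsupp.weight ω m) (Finsupp.weight ω a) with ha | ha
    · rw [hg.2 b (by rintro rfl; omega) (by omega), mul_zero]
    by_cases ham : a = m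
    · subst ham
      rw [hg.2 b (fun h => hab (by rw [h])) (by omega), mul_zero]
    · rw [hf.2 a ham ha, zero_mul]
  constructor
  · rw [coeff_mul, Finset.sum_eq_single (m, m'), hf.1, hg.1]
    · rintro ⟨a, b⟩ hab hne
      have hab : a + b = m + m' := Finset.HasAntidiagonal.mem_antidiagonal.1 hab
      exact key a b (hab ▸ le_rfl) hne
    · intro h
      exact absurd (Finset.HasAntidiagonal.mem_antidiagonal.2 (by rfl)) h
  · intro n hn hw
    rw [coeff_mul]
    refine Finset.sum_eq_zero ?_
    rintro ⟨a, b⟩ hab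
    have hab : a + b = n := Finset.HasAntidiagonal.mem_antidiagonal.1 hab
    refine key a b (hab ▸ hw) fun h => hn ?_
    obtain ⟨rfl, rfl⟩ := Prod.mk.inj h
    exact hab.symm

theorem pow (hf : HasLead ω f m c) (q : ℕ) : HasLead ω (f ^ q) (q • m) (c ^ q) := by
  induction q with
  | zero => rw [pow_zero, pow_zero, zero_smul]; exact HasLead.monomial ω 0 1
  | succ q ih => rw [pow_succ, pow_succ, succ_nsmul]; exact ih.mul hf

theorem exists_coeff_constExp_ne_zero [Fintype σ] (hf : HasLead ω f m c) (hg : HasLead ω g m' d)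
    (hc : c ≠ 0) (hd : d ≠ 0) (hm : ∀ i, m i + m' i ≤ 1) {q : ℕ} (hq : 1 ≤ q) :
    ∃ h, coeff (constExp σ q) (f ^ q * h * g) ≠ 0 := by
  refine ⟨monomial (constExp σ q - (q • m + m')) 1, ?_⟩
  have h := ((hf.pow q).mul (HasLead.monomial ω (constExp σ q - (q • m + m')) 1)).mul hg
  have hexp : q • m + (constExp σ q - (q • m + m')) + m' = constExp σ q := by
    rw [add_right_comm]
    refine add_tsub_cancel_of_le fun i => ?_
    rw [Finsupp.add_apply, Finsupp.smul_apply, constExp_apply, smul_eq_mul]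
    nlinarith [hm i]
  rw [hexp] at h
  rw [h.1, mul_one]
  exact mul_ne_zero (pow_ne_zero _ hc) hd

end HasLead

end Lead

section RegularSequence

open RingTheory.Sequence

variable {R : Type*} [CommRing R]

theorem isWeaklyRegular_iff_regularMod {rs : List R} :
    IsWeaklyRegular R rs ↔
      ∀ i (h : i < rs.length), RegularMod (Ideal.ofList (rs.take i)) rs[i] := by
  rw [isWeaklyRegular_iff]
  refine forall₂_congr fun i h => ?_
  rw [isSMulRegular_quotient_iff_mem_of_smul_mem, smul_eq_mul, Ideal.mul_top]
  rfl

theorem isWeaklyRegular_concat {rs : List R} {r : R} (h : IsWeaklyRegular R rs)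
    (hr : RegularMod (Ideal.ofList rs) r) : IsWeaklyRegular R (rs ++ [r]) := by
  rw [isWeaklyRegular_iff_regularMod] at h ⊢
  intro i hi
  rw [List.length_append, List.length_singleton, Nat.lt_succ_iff_lt_or_eq] at hi
  rcases hi with hi | rfl
  · rw [List.take_append_of_le_length hi.le, List.getElem_append_left hi]
    exact h i hi
  · simpa using hr

/-- If `rs`, `a`, `b`, `c` is a regular sequence in a local ring, so is `a`, `b`, `c`. -/
theorem regularMod_of_isWeaklyRegular [IsNoetherianRing R] [IsLocalRing R] {rs : List R} {a b c : R}
    (hrs : IsWeaklyRegular R rs) (ha : RegularMod (Ideal.ofList rs) a)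
    (hb : RegularMod (Ideal.ofList rs ⊔ Ideal.span {a}) b)
    (hc : RegularMod (Ideal.ofList rs ⊔ Ideal.span {a} ⊔ Ideal.span {b}) c)
    (hmem : ∀ r ∈ rs ++ [a] ++ [b] ++ [c], r ∈ IsLocalRing.maximalIdeal R) :
    RegularMod (Ideal.span {a}) b ∧ RegularMod (Ideal.span {a} ⊔ Ideal.span {b}) c := by
  have h := isWeaklyRegular_concat (isWeaklyRegular_concat (isWeaklyRegular_concat hrs ha)
    (by simpa using hb)) (by simpa [sup_assoc] using hc)
  rw [List.append_assoc, List.append_assoc] at h hmem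
  have h' := isWeaklyRegular_iff_regularMod.1
    (IsLocalRing.isWeaklyRegular_of_perm_of_subset_maximalIdeal h List.perm_append_comm hmem)
  exact ⟨by simpa using h' 1 (by simp), by simpa using h' 2 (by simp)⟩

open MvPowerSeries in
theorem ofList_map_X {σ k : Type} [Field k] [DecidableEq σ] (l : List σ) :
    Ideal.ofList (l.map (X : σ → MvPowerSeries σ k)) = Ideal.span (X '' (l.toFinset : Set σ)) := by
  rw [Ideal.ofList]
  congr 1
  ext
  simp

open MvPowerSeries in
theorem isWeaklyRegular_map_X {σ k : Type} [Field k] {l : List σ} (hl : l.Nodup) :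
    IsWeaklyRegular (MvPowerSeries σ k) (l.map (X : σ → MvPowerSeries σ k)) := by
  classical
  induction l using List.reverseRecOn with
  | nil => exact IsWeaklyRegular.nil _ _
  | append_singleton l i ih =>
    rw [List.map_append, List.map_singleton]
    rw [List.nodup_append] at hl
    refine isWeaklyRegular_concat (ih hl.1) ?_
    rw [ofList_map_X]
    refine regularMod_span_X_image (k := k) _ (n := Finsupp.single i 1) (r := X i)
      (fun j hj => ?_) (by simp)
    exact Finsupp.single_eq_of_ne (hl.2.2 j (List.mem_toFinset.1 hj) i (List.mem_singleton_self i))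

end RegularSequence

theorem sup_span_singleton_congr {R : Type*} [CommRing R] {J : Ideal R} {x y : R}
    (h : x - y ∈ J) : J ⊔ Ideal.span {x} = J ⊔ Ideal.span {y} := by
  apply le_antisymm <;> refine sup_le le_sup_left ?_ <;> rw [Ideal.span_singleton_le_iff_mem]
  · rw [← sub_add_cancel x y]
    exact Ideal.add_mem _ (Ideal.mem_sup_left h)
      (Ideal.mem_sup_right (Ideal.mem_span_singleton_self y))
  · rw [← sub_sub_cancel x y]
    exact Ideal.sub_mem _ (Ideal.mem_sup_right (Ideal.mem_span_singleton_self x))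
      (Ideal.mem_sup_left h)

theorem mul_mem_of_mem_span_range {R ι : Type*} [CommRing R] {D : ι → R} {J : Ideal R} {s f : R}
    (hD : ∀ i, s * D i ∈ J) (hf : f ∈ Ideal.span (Set.range D)) : s * f ∈ J := by
  induction hf using Submodule.span_induction with
  | mem x hx => obtain ⟨i, rfl⟩ := hx; exact hD i
  | zero => rw [mul_zero]; exact zero_mem _
  | add x y _ _ hx hy => rw [mul_add]; exact add_mem hx hy
  | smul a x _ hx => rw [smul_eq_mul, mul_left_comm]; exact Ideal.mul_mem_left _ a hx

section ThreeByTwo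

open MvPowerSeries

variable {k : Type} [Field k]

theorem Gmin32_eq_maximalMinor :
    Gmin32 k = maximalMinor (Matrix.of fun (i : Fin 3) (j : Fin 2) => X (i, j)) := rfl

theorem Gmin32_zero : Gmin32 k 0 = X (1, 0) * X (2, 1) + -(X (1, 1) * X (2, 0)) := by
  rw [Gmin32, Matrix.det_fin_two, sub_eq_add_neg]
  rfl

theorem Gmin32_one : Gmin32 k 1 = X (0, 0) * X (2, 1) + -(X (0, 1) * X (2, 0)) := by
  rw [Gmin32, Matrix.det_fin_two, sub_eq_add_neg]
  rfl

theorem Gmin32_two : Gmin32 k 2 = X (0, 0) * X (1, 1) + -(X (0, 1) * X (1, 0)) := by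
  rw [Gmin32, Matrix.det_fin_two, sub_eq_add_neg]
  rfl

theorem hasLead_Gmin32_zero : HasLead (fun i => i.1 * i.2) (Gmin32 k 0)
    (Finsupp.single (1, 1) 1 + Finsupp.single (2, 0) 1) (-(1 * 1)) := by
  rw [Gmin32_zero, add_comm]
  exact (((HasLead.X _ _).mul (HasLead.X _ _)).neg).add ((HasLead.X _ _).mul (HasLead.X _ _))
    (by simp [Finsupp.weight_single])

theorem hasLead_Gmin32_two : HasLead (fun i => i.1 * i.2) (Gmin32 k 2)
    (Finsupp.single (0, 1) 1 + Finsupp.single (1, 0) 1) (-(1 * 1)) := by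
  rw [Gmin32_two, add_comm]
  exact (((HasLead.X _ _).mul (HasLead.X _ _)).neg).add ((HasLead.X _ _).mul (HasLead.X _ _))
    (by simp [Finsupp.weight_single])

theorem regularMod_I2of32 : RegularMod (I2of32 k) (X (2, 1)) := by
  have hX : Ideal.span {(X (2, 1) : MvPowerSeries (Fin 3 × Fin 2) k)} =
      Ideal.span (X '' (({(2, 1)} : Finset (Fin 3 × Fin 2)) : Set (Fin 3 × Fin 2))) := by simp
  refine regularMod_span_maximalMinor (Matrix.of fun (i : Fin 3) (j : Fin 2) => X (i, j))
    ((HasLead.X (fun _ => 0) (2, 1)).ne_zero one_ne_zero) 0 2 ?_ ?_ <;>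
    rw [← Gmin32_eq_maximalMinor]
  · rw [hX]
    refine regularMod_span_X_image _ ?_ (hasLead_Gmin32_zero.coeff_ne_zero (by simp))
    simp
  · have h : Ideal.span {X (2, 1)} ⊔ Ideal.span {Gmin32 k 0} = Ideal.span {X (2, 1)} ⊔
        Ideal.span {∏ i ∈ ({(1, 1), (2, 0)} : Finset (Fin 3 × Fin 2)), X i} := by
      rw [Finset.prod_pair (by simp), ← Ideal.span_singleton_neg (X (1, 1) * X (2, 0))]
      refine sup_span_singleton_congr ?_
      rw [Gmin32_zero, add_sub_cancel_right]
      exact Ideal.mul_mem_left _ _ (Ideal.mem_span_singleton_self _)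
    rw [h, hX]
    refine regularMod_span_X_image_sup _ ?_ ?_ ?_ (hasLead_Gmin32_two.coeff_ne_zero (by simp)) <;>
      simp

theorem stronglyFRegular_quotient_I2of32 (p : ℕ) [Fact p.Prime] [CharP k p] [PerfectRing k p] :
    StronglyFRegular p (MvPowerSeries (Fin 3 × Fin 2) k ⧸ I2of32 k) := by
  have hmem : ∀ i, Gmin32 k i ∈ I2of32 k := fun i => Ideal.subset_span ⟨i, rfl⟩
  obtain ⟨h, hh⟩ := (hasLead_Gmin32_zero (k := k).mul
    hasLead_Gmin32_two).exists_coeff_constExp_ne_zero (HasLead.X _ (2, 1)) (by simp) one_ne_zero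
    (by rintro ⟨i, j⟩; fin_cases i <;> fin_cases j <;> simp)
    (Nat.le_sub_one_of_lt (Fact.out : p.Prime).one_lt)
  refine stronglyFRegular_quotient (u := (1, 0)) (v := (0, 0)) (s := X (2, 1))
    (a₀ := -(X (1, 1) * X (2, 0))) (b₀ := -(X (0, 1) * X (2, 0))) (by simp)
    (Gmin32_zero (k := k) ▸ hmem 0) (Gmin32_one (k := k) ▸ hmem 1)
    (X_mem_dvdSubring (by simp))
    (neg_mem (mul_mem (X_mem_dvdSubring (by simp)) (X_mem_dvdSubring (by simp))))
    (neg_mem (mul_mem (X_mem_dvdSubring (by simp)) (X_mem_dvdSubring (by simp))))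
    (fun f hf => mul_mem_of_mem_span_range (fun i => ?_) hf) regularMod_I2of32
    (sq (I2of32 k) ▸ Ideal.mul_mem_mul (hmem 0) (hmem 2)) hh
  rw [← Gmin32_zero, ← Gmin32_one]
  refine Ideal.mem_span_pair.2 ?_
  match i with
  | 0 => exact ⟨X (2, 1), 0, by ring⟩
  | 1 => exact ⟨0, X (2, 1), by ring⟩
  | 2 =>
    refine ⟨-X (0, 1), X (1, 1), ?_⟩
    rw [Gmin32_zero, Gmin32_one, Gmin32_two]
    ring

end ThreeByTwo

section FourByThree

open MvPowerSeries

variable {k : Type} [Field k]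

theorem Gmin43_zero : Gmin43 k 0 = X (1, 2) * (X (2, 0) * X (3, 1) + -(X (2, 1) * X (3, 0))) +
    (X (1, 0) * X (2, 1) * X (3, 2) + -(X (1, 0) * X (2, 2) * X (3, 1)) +
      -(X (1, 1) * X (2, 0) * X (3, 2)) + X (1, 1) * X (2, 2) * X (3, 0)) := by
  trans X (1, 0) * X (2, 1) * X (3, 2) - X (1, 0) * X (2, 2) * X (3, 1) -
    X (1, 1) * X (2, 0) * X (3, 2) + X (1, 1) * X (2, 2) * X (3, 0) +
    X (1, 2) * X (2, 0) * X (3, 1) - X (1, 2) * X (2, 1) * X (3, 0)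
  · exact Matrix.det_fin_three _
  · ring

theorem Gmin43_one : Gmin43 k 1 = X (0, 2) * (X (2, 0) * X (3, 1) + -(X (2, 1) * X (3, 0))) +
    (X (0, 0) * X (2, 1) * X (3, 2) + -(X (0, 0) * X (2, 2) * X (3, 1)) +
      -(X (0, 1) * X (2, 0) * X (3, 2)) + X (0, 1) * X (2, 2) * X (3, 0)) := by
  trans X (0, 0) * X (2, 1) * X (3, 2) - X (0, 0) * X (2, 2) * X (3, 1) -
    X (0, 1) * X (2, 0) * X (3, 2) + X (0, 1) * X (2, 2) * X (3, 0) +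
    X (0, 2) * X (2, 0) * X (3, 1) - X (0, 2) * X (2, 1) * X (3, 0)
  · exact Matrix.det_fin_three _
  · ring

theorem Gmin43_two : Gmin43 k 2 =
    X (0, 0) * X (1, 1) * X (3, 2) - X (0, 0) * X (1, 2) * X (3, 1) -
    X (0, 1) * X (1, 0) * X (3, 2) + X (0, 1) * X (1, 2) * X (3, 0) +
    X (0, 2) * X (1, 0) * X (3, 1) - X (0, 2) * X (1, 1) * X (3, 0) :=
  Matrix.det_fin_three _

theorem Gmin43_three : Gmin43 k 3 =
    X (0, 0) * X (1, 1) * X (2, 2) - X (0, 0) * X (1, 2) * X (2, 1) -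
    X (0, 1) * X (1, 0) * X (2, 2) + X (0, 1) * X (1, 2) * X (2, 0) +
    X (0, 2) * X (1, 0) * X (2, 1) - X (0, 2) * X (1, 1) * X (2, 0) :=
  Matrix.det_fin_three _

/-- Weights for which the diagonal terms of the maximal minors of a `4 × 3` matrix have the
smallest weight. -/
def diagWeight (i : Fin 4 × Fin 3) : ℕ := i.1 * (2 - i.2)

theorem hasLead_X_mul_X_mul_X {σ : Type} (ω : σ → ℕ) (a b c : σ) :
    HasLead ω (X a * X b * X c : MvPowerSeries σ k)
      (Finsupp.single a 1 + Finsupp.single b 1 + Finsupp.single c 1) (1 * 1 * 1) :=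
  ((HasLead.X ω a).mul (HasLead.X ω b)).mul (HasLead.X ω c)

theorem hasLead_Gmin43_zero : HasLead diagWeight (Gmin43 k 0)
    (Finsupp.single (1, 0) 1 + Finsupp.single (2, 1) 1 + Finsupp.single (3, 2) 1)
    (1 * 1 * 1) := by
  rw [show Gmin43 k 0 = _ from Matrix.det_fin_three _]
  simp only [sub_eq_add_neg]
  refine HasLead.add (HasLead.add (HasLead.add (HasLead.add (HasLead.add
    (hasLead_X_mul_X_mul_X _ (1, 0) (2, 1) (3, 2))
    (hasLead_X_mul_X_mul_X _ (1, 0) (2, 2) (3, 1)).neg ?_)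
    (hasLead_X_mul_X_mul_X _ (1, 1) (2, 0) (3, 2)).neg ?_)
    (hasLead_X_mul_X_mul_X _ (1, 1) (2, 2) (3, 0)) ?_)
    (hasLead_X_mul_X_mul_X _ (1, 2) (2, 0) (3, 1)) ?_)
    (hasLead_X_mul_X_mul_X _ (1, 2) (2, 1) (3, 0)).neg ?_ <;>
  simp [Finsupp.weight_single, diagWeight]

theorem hasLead_Gmin43_three : HasLead diagWeight (Gmin43 k 3)
    (Finsupp.single (0, 0) 1 + Finsupp.single (1, 1) 1 + Finsupp.single (2, 2) 1)
    (1 * 1 * 1) := by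
  rw [Gmin43_three]
  simp only [sub_eq_add_neg]
  refine HasLead.add (HasLead.add (HasLead.add (HasLead.add (HasLead.add
    (hasLead_X_mul_X_mul_X _ _ _ _) (hasLead_X_mul_X_mul_X _ _ _ _).neg ?_)
    (hasLead_X_mul_X_mul_X _ _ _ _).neg ?_) (hasLead_X_mul_X_mul_X _ _ _ _) ?_)
    (hasLead_X_mul_X_mul_X _ _ _ _) ?_) (hasLead_X_mul_X_mul_X _ _ _ _).neg ?_ <;>
  simp [Finsupp.weight_single, diagWeight]

theorem hasLead_minor43 : HasLead diagWeight
    (X (2, 0) * X (3, 1) + -(X (2, 1) * X (3, 0)) : MvPowerSeries (Fin 4 × Fin 3) k)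
    (Finsupp.single (2, 0) 1 + Finsupp.single (3, 1) 1) (1 * 1) :=
  ((HasLead.X _ _).mul (HasLead.X _ _)).add ((HasLead.X _ _).mul (HasLead.X _ _)).neg
    (by simp [Finsupp.weight_single, diagWeight])

theorem regularMod_I3of43 :
    RegularMod (I3of43 k) (X (2, 0) * X (3, 1) + -(X (2, 1) * X (3, 0))) := by
  let l : List (Fin 4 × Fin 3) := [(0, 1), (0, 2), (1, 2), (3, 0)]
  have hl : ∀ i ∈ l, (X i : MvPowerSeries _ k) ∈ Ideal.span (X '' (l.toFinset : Set _)) :=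
    fun i hi => Ideal.subset_span ⟨i, List.mem_toFinset.2 hi, rfl⟩
  have hs : Ideal.span (X '' (l.toFinset : Set _)) ⊔
      Ideal.span {(X (2, 0) * X (3, 1) + -(X (2, 1) * X (3, 0)) : MvPowerSeries _ k)} =
        Ideal.span (X '' (l.toFinset : Set _)) ⊔
          Ideal.span {∏ i ∈ ({(2, 0), (3, 1)} : Finset (Fin 4 × Fin 3)), X i} := by
    rw [Finset.prod_pair (by simp)]
    refine sup_span_singleton_congr ?_
    rw [add_sub_cancel_left]
    exact neg_mem (Ideal.mul_mem_left _ _ (hl _ (by simp [l])))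
  have hD : Ideal.span (X '' (l.toFinset : Set _)) ⊔
        Ideal.span {∏ i ∈ ({(2, 0), (3, 1)} : Finset (Fin 4 × Fin 3)), X i} ⊔
          Ideal.span {Gmin43 k 3} = Ideal.span (X '' (l.toFinset : Set _)) ⊔
            Ideal.span {∏ i ∈ ({(2, 0), (3, 1)} : Finset (Fin 4 × Fin 3)), X i} ⊔
              Ideal.span {∏ i ∈ ({(0, 0), (1, 1), (2, 2)} : Finset (Fin 4 × Fin 3)), X i} := by
    rw [Finset.prod_insert (a := (0, 0)) (by simp), Finset.prod_pair (a := (1, 1)) (by simp)]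
    refine sup_span_singleton_congr (Ideal.mem_sup_left ?_)
    rw [show Gmin43 k 3 - X (0, 0) * (X (1, 1) * X (2, 2)) =
        (X (0, 1) * (X (1, 2) * X (2, 0) - X (1, 0) * X (2, 2)) +
          X (0, 2) * (X (1, 0) * X (2, 1) - X (1, 1) * X (2, 0))) +
            X (1, 2) * -(X (0, 0) * X (2, 1)) by rw [Gmin43_three]; ring]
    exact add_mem (add_mem (Ideal.mul_mem_right _ _ (hl _ (by simp [l])))
      (Ideal.mul_mem_right _ _ (hl _ (by simp [l])))) (Ideal.mul_mem_right _ _ (hl _ (by simp [l])))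
  have h := regularMod_of_isWeaklyRegular
    (a := (X (2, 0) * X (3, 1) + -(X (2, 1) * X (3, 0)) : MvPowerSeries (Fin 4 × Fin 3) k))
    (b := Gmin43 k 3) (c := Gmin43 k 0)
    (isWeaklyRegular_map_X (show l.Nodup by decide)) ?_ ?_ ?_ ?_
  · exact regularMod_span_maximalMinor (Matrix.of fun (i : Fin 4) (j : Fin 3) => X (i, j))
      (hasLead_minor43.ne_zero (by simp)) 3 0 h.1 h.2
  · rw [ofList_map_X]
    refine regularMod_span_X_image _ ?_ (hasLead_minor43.coeff_ne_zero (by simp))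
    simp [l]
  · rw [ofList_map_X, hs]
    refine regularMod_span_X_image_sup _ ?_ ?_ ?_ (hasLead_Gmin43_three.coeff_ne_zero (by simp)) <;>
      simp [l]
  · rw [ofList_map_X, hs, hD]
    refine regularMod_span_X_image_sup_sup _ ?_ ?_ ?_ ?_ ?_ ?_
      (hasLead_Gmin43_zero.coeff_ne_zero (by simp)) <;> simp [l]
  · intro r hr
    rw [IsLocalRing.mem_maximalIdeal, mem_nonunits_iff, isUnit_iff_constantCoeff]
    simp [l, Gmin43_zero, Gmin43_three] at hr
    rcases hr with rfl | rfl | rfl | rfl | rfl | rfl | rfl <;> simp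

theorem stronglyFRegular_quotient_I3of43 (p : ℕ) [Fact p.Prime] [CharP k p] [PerfectRing k p] :
    StronglyFRegular p (MvPowerSeries (Fin 4 × Fin 3) k ⧸ I3of43 k) := by
  have hmem : ∀ i, Gmin43 k i ∈ I3of43 k := fun i => Ideal.subset_span ⟨i, rfl⟩
  have hX : ∀ i : Fin 4 × Fin 3, i ∉ ({(1, 2), (0, 2)} : Set (Fin 4 × Fin 3)) →
      (X i : MvPowerSeries (Fin 4 × Fin 3) k) ∈ dvdSubring p k {(1, 2), (0, 2)} :=
    fun i hi => X_mem_dvdSubring hi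
  obtain ⟨h, hh⟩ := (hasLead_Gmin43_zero (k := k).mul
    hasLead_Gmin43_three).exists_coeff_constExp_ne_zero hasLead_minor43 (by simp) (by simp)
    (by rintro ⟨i, j⟩; fin_cases i <;> fin_cases j <;> simp)
    (Nat.le_sub_one_of_lt (Fact.out : p.Prime).one_lt)
  refine stronglyFRegular_quotient (u := (1, 2)) (v := (0, 2)) (by simp)
    (Gmin43_zero (k := k) ▸ hmem 0) (Gmin43_one (k := k) ▸ hmem 1) ?_ ?_ ?_
    (fun f hf => mul_mem_of_mem_span_range (fun i => ?_) hf)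
    regularMod_I3of43 (sq (I3of43 k) ▸ Ideal.mul_mem_mul (hmem 0) (hmem 3)) hh
  · exact add_mem (mul_mem (hX _ (by simp)) (hX _ (by simp)))
      (neg_mem (mul_mem (hX _ (by simp)) (hX _ (by simp))))
  iterate 2
    · refine add_mem (add_mem (add_mem ?_ (neg_mem ?_)) (neg_mem ?_)) ?_ <;>
        exact mul_mem (mul_mem (hX _ (by simp)) (hX _ (by simp))) (hX _ (by simp))
  rw [← Gmin43_zero, ← Gmin43_one]
  refine Ideal.mem_span_pair.2 ?_
  match i with
  | 0 => exact ⟨X (2, 0) * X (3, 1) + -(X (2, 1) * X (3, 0)), 0, by ring⟩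
  | 1 => exact ⟨0, X (2, 0) * X (3, 1) + -(X (2, 1) * X (3, 0)), by ring⟩
  | 2 =>
    refine ⟨-(X (0, 0) * X (3, 1) - X (0, 1) * X (3, 0)),
      X (1, 0) * X (3, 1) - X (1, 1) * X (3, 0), ?_⟩
    rw [Gmin43_zero, Gmin43_one, Gmin43_two]
    ring
  | 3 =>
    refine ⟨-(X (0, 0) * X (2, 1) - X (0, 1) * X (2, 0)),
      X (1, 0) * X (2, 1) - X (1, 1) * X (2, 0), ?_⟩
    rw [Gmin43_zero, Gmin43_one, Gmin43_three]
    ring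

end FourByThree

/-- Over a perfect field `k` of characteristic `p > 0`:
(a) `k[[X]]/I₂(X)` for a `3 × 2` generic matrix is strongly `F`-regular for every `p ≥ 2`;
(b) `k[[X]]/I₃(X)` for a `4 × 3` generic matrix is strongly `F`-regular whenever `p ≥ 3`. -/
theorem stmt19 (p : ℕ) (hp : p.Prime) (k : Type) [Field k] [CharP k p]
    (hperf : Function.Surjective fun x : k => x ^ p) :
    StronglyFRegular p (MvPowerSeries (Fin 3 × Fin 2) k ⧸ I2of32 k) ∧
    (3 ≤ p → StronglyFRegular p (MvPowerSeries (Fin 4 × Fin 3) k ⧸ I3of43 k)) := by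
  have := Fact.mk hp
  have : PerfectRing k p := .ofSurjective k p hperf
  exact ⟨stronglyFRegular_quotient_I2of32 p, fun _ => stronglyFRegular_quotient_I3of43 p⟩
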